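/- arXiv:2203.00518 — 2 statements merged into one kernel-verified Lean document; each statement's English description precedes it below -/
import Mathlib

section
/- Let H be a separable real Hilbert space, let n, m₁, m₂ ≥ 1 be integers, let x_1,…,x_n, y_1,…,y_n ∈ H, and let (φ_j)_{j≥1} be an orthonormal family in H. Let V_{m₁,m₂} = span{ φ_k ⊗ φ_j : 1 ≤ j ≤ m₁, 1 ≤ k ≤ m₂ }, a space of finite-rank linear operators on H. Define the m₁×m₁ matrix A = (⟨Γ_n φ_j, φ_k⟩)_{1≤j,k≤m₁} and the m₁×m₂ matrix Y_φ = (⟨Δ_n φ_j, φ_k⟩)_{1≤j≤m₁, 1≤k≤m₂}. If A is invertible, then the least-squares contrast γ_n admits a unique minimizer Ŝ_{m₁,m₂} over V_{m₁,m₂}, and it is given by Ŝ_{m₁,m₂} = Σ_{j=1}^{m₁} Σ_{k=1}^{m₂} b̂_{j,k} φ_k ⊗ φ_j, where the m₁×m₂ coefficient matrix b̂ = (b̂_{j,k}) satisfies b̂ = A^{−1} Y_φ. -/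
open RealInnerProductSpace

/-- The rank-one operator `b ⊗ a : f ↦ ⟨a, f⟩ b`. -/
noncomputable def rankOne {H : Type*} [NormedAddCommGroup H] [InnerProductSpace ℝ H]
    (b a : H) : H →L[ℝ] H := (innerSL ℝ a).smulRight b

/-- The model `V_{m₁,m₂} = span{φ_k ⊗ φ_j : 1 ≤ j ≤ m₁, 1 ≤ k ≤ m₂}` (with `0`-based
indices `j < m₁`, `k < m₂`). -/
noncomputable def opSpan {H : Type*} [NormedAddCommGroup H] [InnerProductSpace ℝ H]
    (φ : ℕ → H) (m₁ m₂ : ℕ) : Submodule ℝ (H →L[ℝ] H) :=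
  Submodule.span ℝ {A : H →L[ℝ] H | ∃ j < m₁, ∃ k < m₂, A = rankOne (φ k) (φ j)}

/-- The least-squares contrast `γ_n(T) = (1/n) Σ_i ‖y_i − T(x_i)‖²`. -/
noncomputable def contrast {H : Type*} [NormedAddCommGroup H] [InnerProductSpace ℝ H]
    {n : ℕ} (x y : Fin n → H) (T : H →L[ℝ] H) : ℝ :=
  (n : ℝ)⁻¹ * ∑ i, ‖y i - T (x i)‖ ^ 2

theorem aux_rankOne_apply {H : Type*} [NormedAddCommGroup H] [InnerProductSpace ℝ H]
    (b a f : H) : rankOne b a f = ⟪a, f⟫ • b := by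
  simp [rankOne]

theorem aux_mem {H : Type*} [NormedAddCommGroup H] [InnerProductSpace ℝ H]
    (φ : ℕ → H) (m₁ m₂ : ℕ) (b : Matrix (Fin m₁) (Fin m₂) ℝ) :
    (∑ j : Fin m₁, ∑ k : Fin m₂, b j k • rankOne (φ (k : ℕ)) (φ (j : ℕ))) ∈ opSpan φ m₁ m₂ := by
  refine Submodule.sum_mem _ fun j _ => Submodule.sum_mem _ fun k _ =>
    Submodule.smul_mem _ _ (Submodule.subset_span ⟨j, j.2, k, k.2, rfl⟩)

theorem aux_exists {H : Type*} [NormedAddCommGroup H] [InnerProductSpace ℝ H]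
    (φ : ℕ → H) (m₁ m₂ : ℕ) (T : H →L[ℝ] H) (hT : T ∈ opSpan φ m₁ m₂) :
    ∃ b : Matrix (Fin m₁) (Fin m₂) ℝ,
      T = ∑ j : Fin m₁, ∑ k : Fin m₂, b j k • rankOne (φ (k : ℕ)) (φ (j : ℕ)) := by
  unfold opSpan at hT
  induction hT using Submodule.span_induction with
  | mem T h =>
    obtain ⟨j, hj, k, hk, rfl⟩ := h
    refine ⟨fun a c => if a = ⟨j, hj⟩ then (if c = ⟨k, hk⟩ then 1 else 0) else 0, ?_⟩
    rw [Finset.sum_eq_single ⟨j, hj⟩, Finset.sum_eq_single ⟨k, hk⟩]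
    · simp
    · intro c _ hc
      simp [hc]
    · simp
    · intro c _ hc
      simp [hc]
    · simp
  | zero => exact ⟨0, by simp⟩
  | add S T _ _ hS hT =>
    obtain ⟨b, rfl⟩ := hS
    obtain ⟨c, rfl⟩ := hT
    exact ⟨b + c, by simp [add_smul, Finset.sum_add_distrib]⟩
  | smul r S _ hS =>
    obtain ⟨b, rfl⟩ := hS
    exact ⟨r • b, by simp [mul_smul, Finset.smul_sum]⟩

theorem aux_coef {H : Type*} [NormedAddCommGroup H] [InnerProductSpace ℝ H]
    (φ : ℕ → H) (hφ : Orthonormal ℝ φ) (m₁ m₂ : ℕ) (b : Matrix (Fin m₁) (Fin m₂) ℝ)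
    (f : H) (k : Fin m₂) :
    ⟪(∑ j : Fin m₁, ∑ k : Fin m₂, b j k • rankOne (φ (k : ℕ)) (φ (j : ℕ))) f, φ (k : ℕ)⟫
      = ∑ j : Fin m₁, ⟪f, φ (j : ℕ)⟫ * b j k := by
  simp only [ContinuousLinearMap.sum_apply, ContinuousLinearMap.smul_apply, aux_rankOne_apply,
    sum_inner, inner_smul_left]
  refine Finset.sum_congr rfl fun j _ => ?_
  rw [Finset.sum_eq_single k]
  · have h : ⟪φ (k : ℕ), φ (k : ℕ)⟫ = (1 : ℝ) := by
      rw [real_inner_self_eq_norm_sq, hφ.1]; norm_num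
    rw [h, real_inner_comm]
    simp [mul_comm]
  · intro c _ hc
    have h : ⟪φ (c : ℕ), φ (k : ℕ)⟫ = (0 : ℝ) := hφ.2 (fun h => hc (Fin.ext h))
    rw [h]; simp
  · simp

theorem aux_mul {n m₁ m₂ : ℕ} (p : Fin n → Fin m₁ → ℝ) (A : Matrix (Fin m₁) (Fin m₁) ℝ)
    (hA : ∀ j l, A j l = (n : ℝ)⁻¹ * ∑ i, p i j * p i l) (b : Matrix (Fin m₁) (Fin m₂) ℝ)
    (j : Fin m₁) (k : Fin m₂) :
    (A * b) j k = (n : ℝ)⁻¹ * ∑ i, p i j * ∑ l, p i l * b l k := by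
  simp only [Matrix.mul_apply, hA, Finset.mul_sum, Finset.sum_mul]
  rw [Finset.sum_comm]
  refine Finset.sum_congr rfl fun i _ => Finset.sum_congr rfl fun l _ => by ring

/-- If the Gram-type matrix `A = (⟨Γ_n φ_j, φ_k⟩)` is invertible, then the
least-squares contrast admits a unique minimizer over `V_{m₁,m₂}`, given by
`Ŝ = Σ_{j,k} (A⁻¹ Y_φ)_{j,k} φ_k ⊗ φ_j`. -/
theorem least_squares_estimator_exists_unique
    {H : Type*} [NormedAddCommGroup H] [InnerProductSpace ℝ H] [CompleteSpace H]
    (n m₁ m₂ : ℕ) (hn : 1 ≤ n) (hm₁ : 1 ≤ m₁) (hm₂ : 1 ≤ m₂)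
    (x y : Fin n → H) (φ : ℕ → H) (hφ : Orthonormal ℝ φ)
    (Γn Δn : H →L[ℝ] H)
    (hΓn : Γn = (n : ℝ)⁻¹ • ∑ i, rankOne (x i) (x i))
    (hΔn : Δn = (n : ℝ)⁻¹ • ∑ i, rankOne (y i) (x i))
    (A : Matrix (Fin m₁) (Fin m₁) ℝ)
    (hA : A = Matrix.of fun (j k : Fin m₁) => ⟪Γn (φ (j : ℕ)), φ (k : ℕ)⟫)
    (Yφ : Matrix (Fin m₁) (Fin m₂) ℝ)
    (hYφ : Yφ = Matrix.of fun (j : Fin m₁) (k : Fin m₂) => ⟪Δn (φ (j : ℕ)), φ (k : ℕ)⟫)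
    (hinv : IsUnit A)
    (Shat : H →L[ℝ] H)
    (hShat : Shat = ∑ j : Fin m₁, ∑ k : Fin m₂,
      (A⁻¹ * Yφ) j k • rankOne (φ (k : ℕ)) (φ (j : ℕ))) :
    Shat ∈ opSpan φ m₁ m₂ ∧
      (∀ T ∈ opSpan φ m₁ m₂, contrast x y Shat ≤ contrast x y T) ∧
      ∀ T ∈ opSpan φ m₁ m₂, contrast x y T = contrast x y Shat → T = Shat := by
  have hn0 : (0 : ℝ) < (n : ℝ)⁻¹ := by
    have : (0 : ℝ) < n := by exact_mod_cast hn
    positivity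
  have hAe : ∀ j l, A j l = (n : ℝ)⁻¹ * ∑ i, ⟪x i, φ (j : ℕ)⟫ * ⟪x i, φ (l : ℕ)⟫ := by
    intro j l
    simp [hA, hΓn, aux_rankOne_apply, inner_smul_left, sum_inner]
  have hYe : ∀ j k, Yφ j k = (n : ℝ)⁻¹ * ∑ i, ⟪x i, φ (j : ℕ)⟫ * ⟪y i, φ (k : ℕ)⟫ := by
    intro j k
    simp [hYφ, hΔn, aux_rankOne_apply, inner_smul_left, sum_inner]
  have hdet : IsUnit A.det := (Matrix.isUnit_iff_isUnit_det A).1 hinv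
  have hmem : Shat ∈ opSpan φ m₁ m₂ := by
    rw [hShat]; exact aux_mem φ m₁ m₂ _
  have hnormal : ∀ (j : Fin m₁) (k : Fin m₂),
      ∑ i, ⟪x i, φ (j : ℕ)⟫ * ⟪y i - Shat (x i), φ (k : ℕ)⟫ = (0 : ℝ) := by
    intro j k
    have h1 := aux_mul (fun i (l : Fin m₁) => (⟪x i, φ (l : ℕ)⟫ : ℝ)) A hAe (A⁻¹ * Yφ) j k
    rw [Matrix.mul_nonsing_inv_cancel_left _ _ hdet, hYe] at h1
    have h2 := mul_left_cancel₀ hn0.ne' h1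
    simp only [inner_sub_left, mul_sub, Finset.sum_sub_distrib]
    rw [h2, hShat]
    simp only [aux_coef φ hφ, sub_self]
  have horth : ∀ D ∈ opSpan φ m₁ m₂, ∑ i, ⟪y i - Shat (x i), D (x i)⟫ = (0 : ℝ) := by
    intro D hD
    unfold opSpan at hD
    induction hD using Submodule.span_induction with
    | mem T h =>
      obtain ⟨j, hj, k, hk, rfl⟩ := h
      rw [← hnormal ⟨j, hj⟩ ⟨k, hk⟩]
      refine Finset.sum_congr rfl fun i _ => ?_
      rw [aux_rankOne_apply, inner_smul_right, real_inner_comm]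
    | zero => simp
    | add S T _ _ hS hT => simp [inner_add_right, Finset.sum_add_distrib, hS, hT]
    | smul r S _ hS => simp [inner_smul_right, ← Finset.mul_sum, hS]
  have hpyth : ∀ T ∈ opSpan φ m₁ m₂, contrast x y T = contrast x y Shat +
      (n : ℝ)⁻¹ * ∑ i, ‖(T - Shat) (x i)‖ ^ 2 := by
    intro T hT
    have h0 := horth (T - Shat) (Submodule.sub_mem _ hT hmem)
    unfold contrast
    rw [← mul_add]
    congr 1
    have : ∀ i, ‖y i - T (x i)‖ ^ 2 = ‖y i - Shat (x i)‖ ^ 2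
        - 2 * ⟪y i - Shat (x i), (T - Shat) (x i)⟫ + ‖(T - Shat) (x i)‖ ^ 2 := by
      intro i
      rw [← norm_sub_sq_real]
      congr 2
      simp
    simp only [this, Finset.sum_add_distrib, Finset.sum_sub_distrib, ← Finset.mul_sum, h0]
    ring
  refine ⟨hmem, fun T hT => ?_, fun T hT hEq => ?_⟩
  · rw [hpyth T hT]
    have : 0 ≤ (n : ℝ)⁻¹ * ∑ i, ‖(T - Shat) (x i)‖ ^ 2 := by positivity
    linarith
  · have h1 := hpyth T hT
    have h2 : ∑ i, ‖(T - Shat) (x i)‖ ^ 2 = 0 := by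
      have : (n : ℝ)⁻¹ * ∑ i, ‖(T - Shat) (x i)‖ ^ 2 = 0 := by linarith
      exact (mul_eq_zero.1 this).resolve_left hn0.ne'
    have h3 : ∀ i, (T - Shat) (x i) = 0 := by
      intro i
      have := (Finset.sum_eq_zero_iff_of_nonneg (fun i _ => by positivity)).1 h2 i
        (Finset.mem_univ i)
      simpa using this
    obtain ⟨d, hd⟩ := aux_exists φ m₁ m₂ _ (Submodule.sub_mem _ hT hmem)
    have h4 : A * d = 0 := by
      ext j k
      rw [aux_mul (fun i (l : Fin m₁) => (⟪x i, φ (l : ℕ)⟫ : ℝ)) A hAe d j k]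
      simp only [← aux_coef φ hφ, ← hd, h3]
      simp
    have h5 : d = 0 := by
      rw [← Matrix.nonsing_inv_mul_cancel_left A d hdet, h4, Matrix.mul_zero]
    rw [h5] at hd
    rw [← sub_eq_zero, hd]
    simp
end

section
/- Let H be a separable real Hilbert space, let n, m₁, m₂ ≥ 1 be integers with m₁, m₂ ≤ J, and let x_1,…,x_n, y_1,…,y_n ∈ H. Suppose (φ̂_j)_{1≤j≤J} is an orthonormal family in H consisting of eigenvectors of the empirical covariance operator Γ_n, i.e. Γ_n φ̂_j = λ̂_j φ̂_j for reals λ̂_j, and that λ̂_j > 0 for all 1 ≤ j ≤ m₁. Then the least-squares contrast γ_n admits a unique minimizer over V_{m₁,m₂} = span{ φ̂_k ⊗ φ̂_j : 1 ≤ j ≤ m₁, 1 ≤ k ≤ m₂ }, and this minimizer equals Ŝ_{m₁,m₂} = Σ_{j=1}^{m₁} Σ_{k=1}^{m₂} λ̂_j^{−1} ⟨Δ_n φ̂_j, φ̂_k⟩ φ̂_k ⊗ φ̂_j. -/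
open RealInnerProductSpace

/-- On an orthonormal family of eigenvectors `(φ̂_j)_{1≤j≤J}` of the
empirical covariance operator `Γ_n`, with positive eigenvalues for the first `m₁` indices,
the least-squares contrast admits a unique minimizer over
`V_{m₁,m₂} = span{φ̂_k ⊗ φ̂_j : j ≤ m₁, k ≤ m₂}`, namely
`Ŝ_{m₁,m₂} = Σ_{j≤m₁} Σ_{k≤m₂} λ̂_j⁻¹ ⟨Δ_n φ̂_j, φ̂_k⟩ φ̂_k ⊗ φ̂_j`. -/
theorem least_squares_estimator_PCA_basis
    {H : Type*} [NormedAddCommGroup H] [InnerProductSpace ℝ H] [CompleteSpace H]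
    (n m₁ m₂ J : ℕ) (hn : 1 ≤ n) (hm₁ : 1 ≤ m₁) (hm₂ : 1 ≤ m₂)
    (hm₁J : m₁ ≤ J) (hm₂J : m₂ ≤ J)
    (x y : Fin n → H) (φ : Fin J → H) (hφ : Orthonormal ℝ φ)
    (Γn Δn : H →L[ℝ] H)
    (hΓn : Γn = (n : ℝ)⁻¹ • ∑ i, rankOne (x i) (x i))
    (hΔn : Δn = (n : ℝ)⁻¹ • ∑ i, rankOne (y i) (x i))
    (lam : Fin J → ℝ) (heig : ∀ j, Γn (φ j) = lam j • φ j)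
    (hpos : ∀ j : Fin J, (j : ℕ) < m₁ → 0 < lam j)
    (V : Submodule ℝ (H →L[ℝ] H))
    (hV : V = Submodule.span ℝ
      {A : H →L[ℝ] H | ∃ (j : Fin m₁) (k : Fin m₂),
        A = rankOne (φ (Fin.castLE hm₂J k)) (φ (Fin.castLE hm₁J j))})
    (Shat : H →L[ℝ] H)
    (hShat : Shat = ∑ j : Fin m₁, ∑ k : Fin m₂,
      ((lam (Fin.castLE hm₁J j))⁻¹ *
          ⟪Δn (φ (Fin.castLE hm₁J j)), φ (Fin.castLE hm₂J k)⟫) •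
        rankOne (φ (Fin.castLE hm₂J k)) (φ (Fin.castLE hm₁J j))) :
    Shat ∈ V ∧
      (∀ T ∈ V, contrast x y Shat ≤ contrast x y T) ∧
      ∀ T ∈ V, contrast x y T = contrast x y Shat → T = Shat := by
  have hn0 : (0 : ℝ) < (n : ℝ)⁻¹ := by
    have : (0 : ℝ) < n := by exact_mod_cast hn
    positivity
  have hr : ∀ b a f : H, rankOne b a f = ⟪a, f⟫ • b := fun b a f => by
    simp [rankOne]
  have hlam : ∀ j : Fin m₁, 0 < lam (Fin.castLE hm₁J j) := fun j => hpos _ (by simp)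
  have hpp : ∀ i j : Fin J, ⟪φ i, φ j⟫ = if i = j then (1 : ℝ) else 0 :=
    fun i j => orthonormal_iff_ite.mp hφ i j
  have hSV : Shat ∈ V := by
    rw [hShat, hV]
    exact Submodule.sum_mem _ fun j _ => Submodule.sum_mem _ fun k _ =>
      Submodule.smul_mem _ _ (Submodule.subset_span ⟨j, k, rfl⟩)
  have hSjk : ∀ (j : Fin m₁) (k : Fin m₂),
      ⟪Shat (φ (Fin.castLE hm₁J j)), φ (Fin.castLE hm₂J k)⟫ =
        (lam (Fin.castLE hm₁J j))⁻¹ * ⟪Δn (φ (Fin.castLE hm₁J j)), φ (Fin.castLE hm₂J k)⟫ := by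
    intro j k
    rw [hShat]
    simp only [ContinuousLinearMap.sum_apply, ContinuousLinearMap.smul_apply, hr, sum_inner,
      real_inner_smul_left, hpp, Fin.castLE_inj]
    simp
  have hΓ : ∀ (R : H →L[ℝ] H) (f : H), R (Γn f) = (n : ℝ)⁻¹ • ∑ i, ⟪x i, f⟫ • R (x i) := by
    intro R f
    rw [hΓn]
    simp [ContinuousLinearMap.sum_apply, hr]
  have hΔ : ∀ (f : H), Δn f = (n : ℝ)⁻¹ • ∑ i, ⟪x i, f⟫ • y i := by
    intro f
    rw [hΔn]
    simp [ContinuousLinearMap.sum_apply, hr]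
  have horth : ∀ R ∈ V, ∑ i, ⟪y i - Shat (x i), R (x i)⟫ = 0 := by
    intro R hR
    rw [hV] at hR
    induction hR using Submodule.span_induction with
    | mem A hA =>
      obtain ⟨j, k, rfl⟩ := hA
      have h1 : (n : ℝ)⁻¹ * ∑ i, ⟪y i - Shat (x i),
          rankOne (φ (Fin.castLE hm₂J k)) (φ (Fin.castLE hm₁J j)) (x i)⟫ =
          ⟪Δn (φ (Fin.castLE hm₁J j)) - Shat (Γn (φ (Fin.castLE hm₁J j))),
            φ (Fin.castLE hm₂J k)⟫ := by
        rw [hΔ, hΓ, ← smul_sub, ← Finset.sum_sub_distrib, real_inner_smul_left, sum_inner]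
        congr 1
        refine Finset.sum_congr rfl fun i _ => ?_
        rw [hr, ← smul_sub, real_inner_smul_left, real_inner_smul_right, real_inner_comm (x i)]
      have h2 : ⟪Δn (φ (Fin.castLE hm₁J j)) - Shat (Γn (φ (Fin.castLE hm₁J j))),
            φ (Fin.castLE hm₂J k)⟫ = 0 := by
        rw [heig, map_smul, inner_sub_left, real_inner_smul_left, hSjk,
          mul_inv_cancel_left₀ (hlam j).ne', sub_self]
      rw [h2] at h1
      exact (mul_eq_zero.mp h1).resolve_left hn0.ne'
    | zero => simp
    | add A B _ _ hA hB =>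
      simp [inner_add_right, Finset.sum_add_distrib, hA, hB]
    | smul c A _ hA =>
      simp [real_inner_smul_right, ← Finset.mul_sum, hA]
  have hrep : ∀ R ∈ V, ∀ v, R v =
      ∑ j : Fin m₁, ⟪φ (Fin.castLE hm₁J j), v⟫ • R (φ (Fin.castLE hm₁J j)) := by
    intro R hR v
    rw [hV] at hR
    induction hR using Submodule.span_induction with
    | mem A hA =>
      obtain ⟨j, k, rfl⟩ := hA
      simp only [hr, hpp, Fin.castLE_inj]
      simp
    | zero => simp
    | add A B _ _ hA hB =>
      simp only [ContinuousLinearMap.add_apply, smul_add, Finset.sum_add_distrib]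
      rw [← hA, ← hB]
    | smul c A _ hA =>
      simp only [ContinuousLinearMap.smul_apply, smul_comm _ c, ← Finset.smul_sum]
      rw [← hA]
  have hpyth : ∀ T ∈ V, contrast x y T =
      contrast x y Shat + (n : ℝ)⁻¹ * ∑ i, ‖(T - Shat) (x i)‖ ^ 2 := by
    intro T hT
    have h0 := horth _ (V.sub_mem hT hSV)
    unfold contrast
    rw [← mul_add, ← Finset.sum_add_distrib]
    congr 1
    have : ∀ i, ‖y i - T (x i)‖ ^ 2 = (‖y i - Shat (x i)‖ ^ 2 + ‖(T - Shat) (x i)‖ ^ 2)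
        - 2 * ⟪y i - Shat (x i), (T - Shat) (x i)⟫ := by
      intro i
      have e : y i - T (x i) = (y i - Shat (x i)) - (T - Shat) (x i) := by
        rw [ContinuousLinearMap.sub_apply]; abel
      rw [e, norm_sub_sq_real]; ring
    rw [Finset.sum_congr rfl fun i _ => this i, Finset.sum_sub_distrib, ← Finset.mul_sum, h0]
    ring
  refine ⟨hSV, fun T hT => ?_, fun T hT h => ?_⟩
  · rw [hpyth T hT]
    have : 0 ≤ (n : ℝ)⁻¹ * ∑ i, ‖(T - Shat) (x i)‖ ^ 2 := by positivity
    linarith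
  · rw [hpyth T hT] at h
    have h1 : (n : ℝ)⁻¹ * ∑ i, ‖(T - Shat) (x i)‖ ^ 2 = 0 := by linarith
    have h2 := (mul_eq_zero.mp h1).resolve_left hn0.ne'
    rw [Finset.sum_eq_zero_iff_of_nonneg (fun i _ => by positivity)] at h2
    have h3 : ∀ i, (T - Shat) (x i) = 0 := fun i => by
      have := h2 i (Finset.mem_univ i)
      exact norm_eq_zero.mp (pow_eq_zero_iff (two_ne_zero) |>.mp this)
    have h4 : ∀ j : Fin m₁, (T - Shat) (φ (Fin.castLE hm₁J j)) = 0 := fun j => by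
      have h5 := hΓ (T - Shat) (φ (Fin.castLE hm₁J j))
      rw [heig, map_smul, Finset.sum_eq_zero (fun i _ => by rw [h3 i, smul_zero]),
        smul_zero] at h5
      exact (smul_eq_zero.mp h5).resolve_left (hlam j).ne'
    rw [← sub_eq_zero]
    ext v
    rw [hrep _ (V.sub_mem hT hSV) v, Finset.sum_eq_zero (fun j _ => by rw [h4 j, smul_zero])]
    rfl
end
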